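/- Let G be a vertex-minimal triangle-free, fork-free graph with chromatic number at least 4, let C be a good 5-cycle in G, let u be a vertex at distance exactly 2 from C, and let v be a vertex of C. Then for any two vertices a, b in N(v) \ V(C), u is adjacent to either both or neither of a and b. -/

import Mathlib

open SimpleGraph

/-- The fork: `K_{1,4}` with two edges subdivided. Vertex 0 is the center,
adjacent to leaves 1, 2 and to 3, 5; paths 0-3-4 and 0-5-6. -/
def fork : SimpleGraph (Fin 7) :=
  SimpleGraph.fromEdgeSet {s(0, 1), s(0, 2), s(0, 3), s(0, 5), s(3, 4), s(5, 6)}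

/-- A graph is fork-free if it has no induced subgraph isomorphic to the fork. -/
def ForkFree {V : Type} (G : SimpleGraph V) : Prop :=
  IsEmpty (fork ↪g G)

/-- `G` is a vertex-minimal triangle-free, fork-free graph with chromatic
number at least 4: every smaller triangle-free fork-free graph is 3-colorable. -/
def MinCex {V : Type} [Fintype V] (G : SimpleGraph V) : Prop :=
  G.CliqueFree 3 ∧ ForkFree G ∧ 4 ≤ G.chromaticNumber ∧
    ∀ (W : Type) [Fintype W] (H : SimpleGraph W),
      Fintype.card W < Fintype.card V → H.CliqueFree 3 → ForkFree H →
        H.chromaticNumber ≤ 3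

/-- `c` describes a 5-cycle in `G`. -/
def IsC5 {V : Type} (G : SimpleGraph V) (c : Fin 5 → V) : Prop :=
  Function.Injective c ∧ ∀ i : Fin 5, G.Adj (c i) (c (i + 1))

/-- Distance from a vertex `u` to the 5-cycle `c`. -/
noncomputable def distC {V : Type} (G : SimpleGraph V) (c : Fin 5 → V) (u : V) : ℕ :=
  Finset.univ.inf' Finset.univ_nonempty fun i => G.dist u (c i)

/-- A good 5-cycle: one minimizing the number of vertices at distance at least 2. -/
def GoodC5 {V : Type} (G : SimpleGraph V) (c : Fin 5 → V) : Prop :=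
  IsC5 G c ∧ ∀ d : Fin 5 → V, IsC5 G d →
    {u : V | 2 ≤ distC G c u}.ncard ≤ {u : V | 2 ≤ distC G d u}.ncard


namespace ForkProof

/-! ## A certificate checker

A configuration consists of `n` distinct named vertices `σ 0, …, σ (n-1)` whose adjacencies are
recorded by bit masks `nb i`, together with a list `L` of masks containing the trace on the named
vertices of every other vertex. The checker below verifies that a configuration is impossible. -/

/-- A fork `(v, l₁, l₂, p, p₂, q, q₂)`: centre, two leaves, two paths. -/
abbrev Hint := ℕ × ℕ × ℕ × ℕ × ℕ × ℕ × ℕ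

/-- A recolouring strategy, branching on the colours of named vertices. -/
inductive CC : Type
  | bad : CC
  | done (g0 g1 g2 : ℕ) : CC
  | split (i : ℕ) (c0 c1 c2 : CC) : CC

/-- The reasons for which a configuration is contradictory. -/
inductive Leaf : Type
  | dom (x y : ℕ) : Leaf
  | good (w d0 d1 d2 d3 d4 : ℕ) : Leaf
  | color (x p q : ℕ) (t : CC) : Leaf

/-- Certificates: eliminate the type `m` by a certificate for the configuration enlarged by a vertex
of that type, then continue. -/
inductive Cert : Type
  | leaf (l : Leaf) : Cert
  | elim (m : ℕ) (hints : List Hint) (L' : List ℕ) (sub rest : Cert) : Cert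

/-- Add a vertex with index `n` and neighbourhood `m`. -/
def addNb (nb : ℕ → ℕ) (n m : ℕ) : ℕ → ℕ := fun i =>
  bif Nat.beq i n then m else bif m.testBit i then nb i ||| 2 ^ n else nb i

def hintOk (nb : ℕ → ℕ) (n : ℕ) : Hint → Bool
  | (v, l1, l2, p, p2, q, q2) =>
    (nb v).testBit l1 && (nb v).testBit l2 && (nb v).testBit p && (nb v).testBit q &&
    (nb p).testBit p2 && (nb q).testBit q2 &&
    !(nb p2).testBit q && !(nb p2).testBit q2 && !(nb p2).testBit l1 && !(nb p2).testBit l2 &&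
    !(nb q2).testBit p && !(nb q2).testBit l1 && !(nb q2).testBit l2 && !Nat.beq l1 l2 &&
    Nat.blt v n && Nat.blt l1 n && Nat.blt l2 n && Nat.blt p n && Nat.blt p2 n && Nat.blt q n &&
    Nat.blt q2 n

def triType (nb : ℕ → ℕ) (n m : ℕ) : Bool :=
  (List.range n).any fun i => m.testBit i &&
    (List.range n).any fun j => m.testBit j && (nb i).testBit j

def badType (nb : ℕ → ℕ) (n : ℕ) (hints : List Hint) (m : ℕ) : Bool :=
  triType nb n m || hints.any (hintOk (addNb nb n m) (n + 1))

/-- Every candidate type is listed in the new list or impossible. -/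
def covers (nb : ℕ → ℕ) (n : ℕ) (cands : List ℕ) (hints : List Hint) (L' : List ℕ) : Bool :=
  cands.all fun m => L'.any (Nat.beq m) || badType nb n hints m

def cands (n : ℕ) (L : List ℕ) : List ℕ := L.flatMap fun m => [m, m ||| 2 ^ n]

def isZ (m : ℕ) : Bool := Nat.beq m 0

def checkDone (nb : ℕ → ℕ) (n : ℕ) (L : List ℕ) (f0 f1 f2 g0 g1 g2 : ℕ) : Bool :=
  ((List.range n).all fun i =>
    (g0.testBit i || g1.testBit i || g2.testBit i) &&
    (!g0.testBit i || isZ (nb i &&& g0)) &&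
    (!g1.testBit i || isZ (nb i &&& g1)) &&
    (!g2.testBit i || isZ (nb i &&& g2))) &&
  L.all fun m =>
    (isZ (g0 &&& m) || !isZ (f0 &&& m)) &&
    (isZ (g1 &&& m) || !isZ (f1 &&& m)) &&
    (isZ (g2 &&& m) || !isZ (f2 &&& m))

def checkCC (nb : ℕ → ℕ) (n : ℕ) (L : List ℕ) (x : ℕ) : CC → ℕ → ℕ → ℕ → Bool
  | .bad, _, _, _ => false
  | .done g0 g1 g2, f0, f1, f2 => checkDone nb n L f0 f1 f2 g0 g1 g2
  | .split i c0 c1 c2, f0, f1, f2 =>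
    Nat.blt i n && !Nat.beq i x &&
    (!isZ (nb i &&& f0) || checkCC nb n L x c0 (f0 ||| 2 ^ i) f1 f2) &&
    (!isZ (nb i &&& f1) || checkCC nb n L x c1 f0 (f1 ||| 2 ^ i) f2) &&
    (!isZ (nb i &&& f2) || checkCC nb n L x c2 f0 f1 (f2 ||| 2 ^ i))

def hit (m : ℕ) (K : List ℕ) : Bool := K.any fun i => m.testBit i

def cov (nb : ℕ → ℕ) (i : ℕ) (K : List ℕ) : Bool := K.any (Nat.beq i) || hit (nb i) K

def checkGood (nb : ℕ → ℕ) (n : ℕ) (L : List ℕ) (w : ℕ) (d0 d1 d2 d3 d4 : ℕ) : Bool :=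
  let C := [0, 1, 2, 3, 4]
  let K := [d0, d1, d2, d3, d4]
  K.all (fun i => Nat.blt i n) && Nat.blt w n && Nat.blt 4 n && decide K.Nodup &&
  (nb d0).testBit d1 && (nb d1).testBit d2 && (nb d2).testBit d3 && (nb d3).testBit d4 &&
  (nb d4).testBit d0 &&
  (L.all fun m => !hit m C || hit m K) &&
  ((List.range n).all fun i => !cov nb i C || cov nb i K) &&
  cov nb w K && !cov nb w C

def checkLeaf (nb : ℕ → ℕ) (n : ℕ) (L : List ℕ) : Leaf → Bool
  | .dom x y => Nat.blt x n && Nat.blt y n && !Nat.beq x y &&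
      ((List.range n).all fun j => !(nb x).testBit j || (nb y).testBit j) &&
      L.all fun m => !m.testBit x || m.testBit y
  | .good w d0 d1 d2 d3 d4 => checkGood nb n L w d0 d1 d2 d3 d4
  | .color x p q t => Nat.blt x n && Nat.blt p n && Nat.blt q n && !Nat.beq p x && !Nat.beq q x &&
      (nb p).testBit q && checkCC nb n L x t (2 ^ p) (2 ^ q) 0

def check : Cert → (ℕ → ℕ) → ℕ → List ℕ → Bool
  | .leaf l, nb, n, L => checkLeaf nb n L l
  | .elim m hints L' sub rest, nb, n, L =>
    (L.all fun m => Nat.blt m (2 ^ n)) && Nat.blt m (2 ^ n) &&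
    covers (addNb nb n m) (n + 1) (cands n L) hints L' &&
    check sub (addNb nb n m) (n + 1) L' &&
    check rest nb n (L.filter fun m' => !Nat.beq m' m)

/-! ## The certificate -/

def rootHints : List Hint :=
  [(2, 1, 8, 5, 7, 3, 4), (0, 1, 6, 4, 8, 5, 7), (0, 4, 6, 1, 8, 5, 7), (0, 4, 6, 8, 7, 1, 2), (0, 1, 4, 6, 8, 5, 7), (0, 1, 8, 5, 7, 4, 3), (3, 4, 6, 8, 7, 2, 1)]

def rootTypes : List ℕ :=
  [0, 8, 9, 18, 32, 34, 40, 42, 48, 50, 66, 80, 82, 84, 96, 98, 112, 114, 128, 130, 132, 133, 138, 144, 146, 148, 192, 194, 196, 208, 210, 212]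

def rootNb : List ℕ := [114, 5, 42, 84, 9, 133, 9, 32]

def rootCert : Cert :=
  .elim 196 [(6, 3, 9, 8, 7, 0, 1), (2, 5, 8, 1, 9, 3, 4), (0, 1, 4, 5, 9, 6, 8), (0, 1, 5, 4, 9, 6, 8), (0, 4, 5, 1, 9, 6, 8), (2, 1, 5, 8, 9, 3, 4), (8, 6, 7, 9, 4, 2, 1)]
    [0, 8, 264, 9, 265, 18, 274, 288, 34, 290, 296, 42, 298, 48, 50, 306, 82, 98, 114, 128, 132, 133, 146, 192, 196, 208, 210, 212]
    (
    .leaf (.good 7 0 4 3 2 5)) <|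
  .elim 146 [(5, 0, 9, 7, 8, 2, 3), (1, 0, 9, 8, 7, 2, 3), (2, 5, 9, 1, 8, 3, 6), (3, 6, 9, 4, 8, 2, 5), (5, 2, 9, 7, 8, 0, 6), (4, 0, 9, 8, 7, 3, 2), (8, 1, 9, 7, 5, 4, 3), (8, 4, 7, 9, 6, 1, 2)]
    [0, 264, 265, 288, 296, 84, 128, 130, 144, 146, 192, 194, 208, 210, 212]
    (
    .leaf (.good 7 0 4 8 7 5)) <|
  .elim 194 [(5, 0, 9, 7, 8, 2, 3), (1, 0, 9, 8, 7, 2, 3), (3, 4, 9, 6, 8, 2, 5), (2, 5, 9, 1, 8, 3, 4), (5, 2, 9, 7, 8, 0, 4), (6, 0, 9, 8, 7, 3, 2), (8, 1, 9, 7, 5, 6, 3), (8, 6, 7, 9, 4, 1, 2)]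
    [0, 264, 265, 288, 296, 84, 128, 130, 144, 148, 192, 194, 208, 210, 212]
    (
    .leaf (.good 7 0 5 7 8 6)) <|
  .elim 48 [(5, 0, 8, 7, 9, 2, 3), (2, 1, 9, 5, 8, 3, 6), (3, 6, 9, 4, 8, 2, 1), (5, 0, 7, 8, 9, 2, 3), (5, 2, 7, 9, 6, 8, 4), (3, 2, 6, 4, 8, 9, 7), (4, 3, 8, 9, 7, 0, 1), (5, 2, 7, 8, 9, 0, 6), (5, 7, 8, 9, 6, 2, 1), (5, 7, 9, 8, 4, 2, 1)]
    [0, 265, 18, 34, 42, 48, 50, 66, 80, 82, 84, 114, 384, 386, 388, 389, 394, 448]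
    (
    .leaf (.dom 7 8)) <|
  .elim 130 [(1, 0, 9, 8, 7, 2, 3), (5, 2, 9, 7, 8, 0, 4), (2, 5, 9, 1, 8, 3, 6), (3, 4, 6, 9, 8, 2, 5), (0, 4, 5, 6, 9, 1, 8), (0, 5, 6, 4, 9, 1, 8), (5, 0, 9, 7, 8, 2, 3)]
    [0, 256, 8, 9, 288, 296, 80, 336, 84, 340, 352, 368, 128, 130, 138, 208, 210, 212]
    (
    .leaf (.dom 4 6)) <|
  .elim 84 [(4, 3, 8, 9, 7, 0, 1), (2, 3, 8, 1, 9, 5, 7), (2, 1, 8, 3, 9, 5, 7), (2, 1, 3, 8, 9, 5, 7), (2, 3, 8, 9, 7, 1, 0), (6, 3, 8, 9, 7, 0, 1), (8, 4, 6, 9, 7, 2, 1)]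
    [0, 264, 265, 32, 288, 34, 290, 40, 296, 42, 298, 50, 80, 84, 96, 98, 112, 114, 128, 133, 138, 394, 210]
    (
    .leaf (.good 7 0 4 3 2 5)) <|
  .elim 32 [(5, 0, 7, 8, 9, 2, 3), (5, 0, 8, 7, 9, 2, 3), (2, 1, 9, 5, 8, 3, 6), (3, 4, 6, 9, 8, 2, 1), (5, 7, 8, 9, 6, 2, 1), (0, 4, 6, 1, 9, 5, 8), (5, 7, 8, 9, 3, 0, 1)]
    [0, 8, 9, 18, 32, 34, 42, 50, 66, 80, 82, 98, 114, 384, 388, 389, 394, 400, 404, 448, 464, 466, 212, 468]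
    (
    .leaf (.dom 8 7)) <|
  .elim 144 [(4, 0, 9, 8, 7, 3, 2), (3, 6, 9, 4, 8, 2, 1), (5, 0, 9, 7, 8, 2, 3), (0, 1, 5, 6, 9, 4, 8), (0, 5, 6, 1, 9, 4, 8), (5, 2, 9, 7, 8, 0, 6)]
    [0, 256, 264, 265, 290, 296, 298, 66, 322, 352, 354, 128, 132, 133, 144, 148, 208, 210, 212]
    (
    .elim 144 [(4, 0, 9, 8, 10, 3, 2), (3, 6, 10, 4, 9, 2, 1), (4, 0, 8, 9, 10, 3, 2), (7, 8, 9, 10, 6, 5, 2), (4, 8, 9, 0, 6, 10, 2), (5, 2, 10, 7, 9, 0, 6)]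
      [0, 768, 776, 777, 802, 808, 810, 66, 834, 864, 866, 128, 132, 133, 144, 212]
      (
      .leaf (.dom 8 9)) <|
    .elim 265 [(0, 1, 5, 6, 10, 9, 8), (0, 4, 6, 9, 10, 1, 2), (0, 4, 9, 1, 10, 5, 7), (0, 4, 9, 6, 10, 1, 2), (9, 0, 10, 8, 7, 3, 2)]
      [0, 256, 264, 265, 290, 296, 298, 354, 128, 132, 644, 133, 148, 660, 720, 210, 722, 724]
      (
      .leaf (.good 7 0 4 3 2 5)) <|
    .elim 322 [(4, 3, 10, 8, 9, 0, 5), (2, 5, 10, 1, 9, 3, 4), (8, 4, 10, 7, 5, 9, 1), (9, 6, 10, 8, 4, 1, 2), (1, 0, 10, 9, 8, 2, 3), (8, 7, 10, 4, 3, 9, 1), (8, 9, 10, 7, 5, 4, 3)]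
      [0, 290, 296, 298, 354, 128, 644, 645, 660]
      (
      .leaf (.good 7 0 1 9 8 4)) <|
    .elim 148 [(2, 1, 5, 9, 10, 3, 6), (4, 3, 9, 8, 10, 0, 1), (0, 1, 6, 5, 10, 4, 9), (4, 3, 8, 9, 10, 0, 5), (9, 4, 7, 10, 6, 2, 1)]
      [0, 264, 776, 290, 802, 808, 298, 810, 66, 354, 866, 128, 132, 133, 148, 208, 210, 212]
      (
      .leaf (.color 9 7 8 (.split 0 (.split 4 .bad .bad (.split 1 .bad (.split 6 .bad (.split 3 (.split 2 .bad .bad (.done 137 866 20)) .bad .bad) (.done 133 810 80)) (.done 133 808 82))) (.split 5 .bad .bad (.split 6 (.split 1 (.split 2 .bad (.split 3 .bad .bad (.done 210 261 552)) .bad) .bad (.done 212 777 34)) .bad (.done 148 777 98))) (.split 4 (.split 5 .bad (.split 1 (.split 2 .bad .bad (.done 210 808 5)) (.split 6 (.done 212 810 1) (.split 3 .bad .bad (.done 148 866 9)) .bad) .bad) .bad) .bad .bad)))) <|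
    .elim 352 [(5, 0, 9, 7, 10, 2, 3), (2, 1, 10, 5, 9, 3, 4), (3, 4, 10, 6, 9, 2, 1), (8, 4, 7, 9, 6, 10, 1), (9, 6, 10, 8, 4, 5, 2), (4, 3, 10, 8, 9, 0, 1), (6, 0, 10, 9, 8, 3, 2), (8, 7, 9, 4, 3, 10, 1)]
      [0, 256, 352, 644, 645]
      (
      .leaf (.dom 1 5)) <|
    .elim 296 [(3, 4, 6, 9, 10, 2, 1), (5, 2, 7, 9, 10, 0, 4), (5, 2, 9, 7, 10, 0, 4)]
      [0, 256, 264, 290, 296, 298, 66, 354, 132, 644, 133, 645, 208, 720, 210, 722, 212, 724]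
      (
      .leaf (.color 9 7 8 (.split 0 (.split 4 .bad .bad (.split 1 .bad (.split 6 .bad (.split 3 (.split 2 .bad .bad (.done 137 354 532)) .bad .bad) (.done 645 298 80)) (.done 645 296 82))) (.split 5 .bad .bad (.split 6 (.split 1 (.split 2 .bad (.split 3 .bad .bad (.done 722 261 40)) .bad) .bad (.done 724 265 34)) .bad (.done 645 296 82))) (.split 4 (.split 5 .bad (.split 1 (.split 2 .bad .bad (.done 722 296 5)) (.split 6 (.done 724 298 1) (.split 3 .bad .bad (.done 660 354 9)) .bad) .bad) .bad) .bad .bad)))) <|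
    .elim 133 [(0, 1, 5, 9, 10, 4, 3), (0, 4, 6, 1, 10, 9, 7), (0, 5, 9, 1, 10, 4, 3), (9, 0, 10, 7, 8, 2, 3)]
      [0, 256, 264, 776, 802, 810, 354, 866, 128, 132, 133, 208, 210, 212]
      (
      .leaf (.good 7 0 4 3 2 5)) <|
    .leaf (.color 0 7 8 (.split 1 (.split 2 .bad (.split 5 .bad .bad (.split 3 (.split 6 .bad (.done 212 298 1) (.done 133 296 82)) .bad (.done 210 261 40))) (.done 210 296 5)) (.split 6 (.done 212 298 1) (.split 3 (.split 2 .bad .bad (.split 4 .bad .bad (.done 137 354 20))) .bad (.done 148 354 9)) (.done 133 298 80)) (.split 4 (.split 6 (.done 212 265 34) (.split 3 .bad .bad (.done 148 354 9)) (.done 133 296 82)) .bad (.done 133 296 82))))) <|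
  .elim 66 [(3, 4, 9, 6, 8, 2, 5), (6, 0, 8, 9, 7, 3, 2), (2, 5, 9, 1, 8, 3, 4), (5, 2, 7, 9, 8, 0, 4)]
    [0, 256, 264, 265, 18, 34, 40, 42, 50, 66, 80, 82, 96, 98, 112, 114, 128, 384, 388, 389, 148, 404, 212]
    (
    .elim 18 [(2, 5, 10, 1, 9, 3, 6), (1, 0, 8, 9, 10, 2, 3), (1, 0, 9, 8, 10, 2, 3), (1, 2, 10, 8, 6, 9, 4), (3, 6, 10, 4, 9, 2, 5), (10, 2, 7, 8, 6, 9, 4), (1, 8, 10, 2, 5, 9, 4), (1, 9, 10, 8, 6, 2, 5), (3, 2, 10, 4, 9, 6, 8), (5, 2, 7, 10, 9, 0, 6), (10, 2, 7, 4, 9, 6, 8)]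
      [0, 768, 776, 777, 50, 80, 82, 96, 98, 112, 114, 128, 896]
      (
      .leaf (.color 9 1 8 (.split 6 (.split 7 (.split 0 .bad (.split 5 .bad .bad (.split 2 .bad (.split 3 .bad .bad (.done 210 773 40)) .bad)) (.split 5 .bad (.done 210 808 5) .bad)) (.done 114 905 4) (.done 114 777 132)) .bad (.split 0 .bad (.split 4 (.split 3 .bad (.split 2 .bad .bad (.split 5 (.split 7 .bad (.done 114 905 4) (.done 114 777 132)) .bad .bad)) .bad) .bad (.split 7 (.done 132 777 114) (.done 4 905 114) (.split 5 (.done 34 777 212) .bad .bad))) .bad)))) <|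
    .leaf (.good 7 0 5 2 3 6)) <|
  .leaf (.good 7 0 4 3 2 5)


def rootCheck : Bool :=
  covers (fun i => rootNb.getD i 0) 8 (List.range 256) rootHints rootTypes &&
    check rootCert (fun i => rootNb.getD i 0) 8 rootTypes

set_option maxRecDepth 100000 in
theorem rootCheck_true : rootCheck = true := by decide +kernel

/-! ## Soundness of the checker -/

section Sound

variable {V : Type} (G : SimpleGraph V)

/-- The facts about a minimal counterexample with a good cycle `c` which the checker uses. -/
structure Ctx (c : Fin 5 → V) : Prop where
  tf : ∀ x y z, G.Adj x y → G.Adj y z → G.Adj x z → False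
  ff : ∀ v l1 l2 p p2 q q2, G.Adj v l1 → G.Adj v l2 → G.Adj v p → G.Adj v q → G.Adj p p2 →
    G.Adj q q2 → ¬ G.Adj p2 q → ¬ G.Adj p2 q2 → ¬ G.Adj p2 l1 → ¬ G.Adj p2 l2 →
    ¬ G.Adj q2 p → ¬ G.Adj q2 l1 → ¬ G.Adj q2 l2 → l1 ≠ l2 → False
  col : ∀ x, ∃ f : V → Fin 3, ∀ y z, y ≠ x → z ≠ x → G.Adj y z → f y ≠ f z
  ncol : ∀ f : V → Fin 3, (∀ y z, G.Adj y z → f y ≠ f z) → False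
  good : ∀ d : Fin 5 → V, IsC5 G d →
    (∀ z, (∃ i, z = c i ∨ G.Adj z (c i)) → ∃ i, z = d i ∨ G.Adj z (d i)) →
    ∀ w, (∃ i, w = d i ∨ G.Adj w (d i)) → ∃ i, w = c i ∨ G.Adj w (c i)

/-- The named vertices realize the adjacency masks. -/
structure Realizes (nb : ℕ → ℕ) (n : ℕ) (σ : ℕ → V) : Prop where
  adj : ∀ i < n, ∀ j < n, (G.Adj (σ i) (σ j) ↔ (nb i).testBit j = true)
  inj : ∀ i < n, ∀ j < n, σ i = σ j → i = j
  bnd : ∀ i < n, nb i < 2 ^ n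

/-- `z` has trace `m` on the named vertices. -/
def HasType (n : ℕ) (σ : ℕ → V) (z : V) (m : ℕ) : Prop :=
  ∀ i < n, (G.Adj z (σ i) ↔ m.testBit i = true)

/-- All unnamed vertices have a type in `L`. -/
def Outside (n : ℕ) (σ : ℕ → V) (L : List ℕ) : Prop :=
  ∀ z, (∀ i < n, z ≠ σ i) → ∃ m ∈ L, HasType G n σ z m

variable {G}

theorem beq_false_of_lt {i n : ℕ} (hi : i < n) : Nat.beq i n = false := by
  rw [← Bool.not_eq_true, Nat.beq_eq]
  omega

theorem addNb_self (nb : ℕ → ℕ) (n m : ℕ) : addNb nb n m n = m := by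
  simp [addNb]

theorem addNb_lt (nb : ℕ → ℕ) {n m i j : ℕ} (hi : i < n) (hj : j < n) :
    (addNb nb n m i).testBit j = (nb i).testBit j := by
  unfold addNb
  rw [beq_false_of_lt hi]
  cases h : m.testBit i
  · simp
  · simp only [cond_false, cond_true, Nat.testBit_or, Nat.testBit_two_pow]
    have : ¬ n = j := by omega
    simp [this]

theorem addNb_last (nb : ℕ → ℕ) {n m i : ℕ} (hi : i < n) (hb : (nb i).testBit n = false) :
    (addNb nb n m i).testBit n = m.testBit i := by
  unfold addNb
  rw [beq_false_of_lt hi]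
  cases h : m.testBit i
  · simp [hb]
  · simp [Nat.testBit_or]

theorem addNb_bnd (nb : ℕ → ℕ) {n m i : ℕ} (hb : i < n → nb i < 2 ^ n) (hm : m < 2 ^ n)
    (hi : i < n + 1) : addNb nb n m i < 2 ^ (n + 1) := by
  have h2 : 2 ^ n < 2 ^ (n + 1) := Nat.pow_lt_pow_right (by norm_num) (by omega)
  rcases Nat.lt_succ_iff_lt_or_eq.1 hi with h | h
  · unfold addNb
    rw [beq_false_of_lt h]
    have := hb h
    cases m.testBit i
    · simp only [cond_false]
      omega
    · simp only [cond_false, cond_true]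
      exact Nat.or_lt_two_pow (by omega) h2
  · subst h
    rw [addNb_self]
    omega

/-- Name one more vertex. -/
def ext (σ : ℕ → V) (n : ℕ) (z : V) : ℕ → V := fun i => if i = n then z else σ i

theorem ext_self (σ : ℕ → V) (n : ℕ) (z : V) : ext σ n z n = z := by simp [ext]

theorem ext_lt (σ : ℕ → V) {n i : ℕ} (z : V) (h : i < n) : ext σ n z i = σ i := by
  have : i ≠ n := by omega
  simp [ext, this]

theorem realizes_ext {nb : ℕ → ℕ} {n m : ℕ} {σ : ℕ → V} {z : V} (hR : Realizes G nb n σ)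
    (hz : ∀ i < n, z ≠ σ i) (ht : HasType G n σ z m) (hm : m < 2 ^ n) :
    Realizes G (addNb nb n m) (n + 1) (ext σ n z) := by
  refine ⟨?_, ?_, fun i hi => addNb_bnd nb (hR.bnd i) hm hi⟩
  · intro i hi j hj
    rcases Nat.lt_succ_iff_lt_or_eq.1 hi with h | h <;>
    rcases Nat.lt_succ_iff_lt_or_eq.1 hj with h' | h'
    · rw [ext_lt σ z h, ext_lt σ z h', addNb_lt nb h h']
      exact hR.adj i h j h'
    · subst h'
      rw [ext_lt σ z h, ext_self, addNb_last nb h (Nat.testBit_lt_two_pow (hR.bnd i h)),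
        G.adj_comm]
      exact ht i h
    · subst h
      rw [ext_lt σ z h', ext_self, addNb_self]
      exact ht j h'
    · subst h h'
      rw [addNb_self, Nat.testBit_lt_two_pow hm]
      simp
  · intro i hi j hj hij
    rcases Nat.lt_succ_iff_lt_or_eq.1 hi with h | h <;>
    rcases Nat.lt_succ_iff_lt_or_eq.1 hj with h' | h'
    · rw [ext_lt σ z h, ext_lt σ z h'] at hij
      exact hR.inj i h j h' hij
    · subst h'
      rw [ext_lt σ z h, ext_self] at hij
      exact absurd hij.symm (hz i h)
    · subst h
      rw [ext_lt σ z h', ext_self] at hij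
      exact absurd hij (hz j h')
    · omega

variable {c : Fin 5 → V}

theorem hintOk_sound (hC : Ctx G c) {nb : ℕ → ℕ} {n : ℕ} {σ : ℕ → V} (hR : Realizes G nb n σ)
    (h : Hint) (hh : hintOk nb n h = true) : False := by
  obtain ⟨v, l1, l2, p, p2, q, q2⟩ := h
  simp only [hintOk, Bool.and_eq_true, Bool.not_eq_true', Nat.blt_eq] at hh
  obtain ⟨⟨⟨⟨⟨⟨⟨⟨⟨⟨⟨⟨⟨⟨⟨⟨⟨⟨⟨⟨a1, a2⟩, a3⟩, a4⟩, a5⟩, a6⟩, b1⟩, b2⟩, b3⟩, b4⟩, b5⟩, b6⟩, b7⟩, b8⟩,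
    hv⟩, hl1⟩, hl2⟩, hp⟩, hp2⟩, hq⟩, hq2⟩ := hh
  have pos : ∀ i < n, ∀ j < n, (nb i).testBit j = true → G.Adj (σ i) (σ j) :=
    fun i hi j hj h => (hR.adj i hi j hj).2 h
  have neg : ∀ i < n, ∀ j < n, (nb i).testBit j = false → ¬ G.Adj (σ i) (σ j) := by
    intro i hi j hj h h'
    rw [hR.adj i hi j hj, h] at h'
    exact Bool.noConfusion h'
  refine hC.ff (σ v) (σ l1) (σ l2) (σ p) (σ p2) (σ q) (σ q2) (pos _ hv _ hl1 a1)
    (pos _ hv _ hl2 a2) (pos _ hv _ hp a3) (pos _ hv _ hq a4) (pos _ hp _ hp2 a5)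
    (pos _ hq _ hq2 a6) (neg _ hp2 _ hq b1) (neg _ hp2 _ hq2 b2) (neg _ hp2 _ hl1 b3)
    (neg _ hp2 _ hl2 b4) (neg _ hq2 _ hp b5) (neg _ hq2 _ hl1 b6) (neg _ hq2 _ hl2 b7) ?_
  intro he
  exact Nat.ne_of_beq_eq_false b8 (hR.inj _ hl1 _ hl2 he)

theorem badType_sound (hC : Ctx G c) {nb : ℕ → ℕ} {n m : ℕ} {σ : ℕ → V} {z : V}
    {hints : List Hint} (hR : Realizes G nb n σ) (hz : ∀ i < n, z ≠ σ i)
    (ht : HasType G n σ z m) (hm : m < 2 ^ n) (hb : badType nb n hints m = true) : False := by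
  unfold badType at hb
  rw [Bool.or_eq_true] at hb
  rcases hb with hb | hb
  · simp only [triType, List.any_eq_true, List.mem_range, Bool.and_eq_true] at hb
    obtain ⟨i, hi, hmi, j, hj, hmj, hij⟩ := hb
    exact hC.tf z (σ i) (σ j) ((ht i hi).2 hmi) ((hR.adj i hi j hj).2 hij) ((ht j hj).2 hmj)
  · rw [List.any_eq_true] at hb
    obtain ⟨h, -, hh⟩ := hb
    exact hintOk_sound hC (realizes_ext hR hz ht hm) h hh

theorem covers_sound (hC : Ctx G c) {nb : ℕ → ℕ} {n : ℕ} {σ : ℕ → V} {K L' : List ℕ}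
    {hints : List Hint} (hR : Realizes G nb n σ) (hK : ∀ m ∈ K, m < 2 ^ n)
    (hO : Outside G n σ K) (h : covers nb n K hints L' = true) : Outside G n σ L' := by
  intro z hz
  obtain ⟨m, hm, ht⟩ := hO z hz
  simp only [covers, List.all_eq_true, Bool.or_eq_true] at h
  rcases h m hm with h | h
  · rw [List.any_eq_true] at h
    obtain ⟨m', hm', he⟩ := h
    rw [Nat.beq_eq] at he
    subst he
    exact ⟨m, hm', ht⟩
  · exact (badType_sound hC hR hz ht (hK m hm) h).elim

theorem cands_sound {n : ℕ} {σ : ℕ → V} {L : List ℕ} {z : V}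
    (hL : ∀ m ∈ L, m < 2 ^ n) (hO : Outside G n σ L) :
    Outside G (n + 1) (ext σ n z) (cands n L) := by
  intro y hy
  obtain ⟨m, hm, ht⟩ := hO y (fun i hi => by
    have := hy i (by omega)
    rwa [ext_lt σ z hi] at this)
  by_cases hyz : G.Adj y z
  · refine ⟨m ||| 2 ^ n, by simp only [cands, List.mem_flatMap]; exact ⟨m, hm, by simp⟩, ?_⟩
    intro i hi
    rcases Nat.lt_succ_iff_lt_or_eq.1 hi with h | h
    · rw [ext_lt σ z h, ht i h, Nat.testBit_or, Nat.testBit_two_pow]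
      have : ¬ n = i := by omega
      simp [this]
    · subst h
      rw [ext_self]
      simp [hyz, Nat.testBit_or]
  · refine ⟨m, by simp only [cands, List.mem_flatMap]; exact ⟨m, hm, by simp⟩, ?_⟩
    intro i hi
    rcases Nat.lt_succ_iff_lt_or_eq.1 hi with h | h
    · rw [ext_lt σ z h]
      exact ht i h
    · subst h
      rw [ext_self, Nat.testBit_lt_two_pow (hL m hm)]
      simp [hyz]

theorem cands_lt {n : ℕ} {L : List ℕ} (hL : ∀ m ∈ L, m < 2 ^ n) :
    ∀ m ∈ cands n L, m < 2 ^ (n + 1) := by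
  intro m hm
  have h2 : 2 ^ n < 2 ^ (n + 1) := Nat.pow_lt_pow_right (by norm_num) (by omega)
  simp only [cands, List.mem_flatMap] at hm
  obtain ⟨m', hm', h⟩ := hm
  have := hL m' hm'
  simp only [List.mem_cons, List.not_mem_nil, or_false] at h
  rcases h with rfl | rfl
  · omega
  · exact Nat.or_lt_two_pow (by omega) h2

/-! ### Leaves -/

theorem isZ_false {a b : ℕ} (h : isZ (a &&& b) = false) :
    ∃ i, a.testBit i = true ∧ b.testBit i = true := by
  have h1 : a &&& b ≠ 0 := Nat.ne_of_beq_eq_false h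
  obtain ⟨i, hi⟩ := Nat.exists_testBit_of_ne_zero h1
  rw [Nat.testBit_and, Bool.and_eq_true] at hi
  exact ⟨i, hi⟩

theorem isZ_true {a b : ℕ} (h : isZ (a &&& b) = true) (i : ℕ) (ha : a.testBit i = true)
    (hb : b.testBit i = true) : False := by
  unfold isZ at h
  rw [Nat.beq_eq] at h
  have : (a &&& b).testBit i = true := by rw [Nat.testBit_and, ha, hb]; rfl
  rw [h] at this
  simp at this

theorem dom_sound (hC : Ctx G c) {nb : ℕ → ℕ} {n : ℕ} {σ : ℕ → V} {L : List ℕ} {x y : ℕ}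
    (hR : Realizes G nb n σ) (hO : Outside G n σ L)
    (h : checkLeaf nb n L (.dom x y) = true) : False := by
  simp only [checkLeaf, Bool.and_eq_true, Nat.blt_eq, Bool.not_eq_true', List.all_eq_true,
    List.mem_range, Bool.or_eq_true] at h
  obtain ⟨⟨⟨⟨hx, hy⟩, hxy⟩, h1⟩, h2⟩ := h
  have hne : σ x ≠ σ y := fun he => Nat.ne_of_beq_eq_false hxy (hR.inj _ hx _ hy he)
  have key : ∀ z, G.Adj z (σ x) → G.Adj z (σ y) := by
    intro z hz
    by_cases hn : ∃ i < n, z = σ i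
    · obtain ⟨i, hi, rfl⟩ := hn
      have h3 := (hR.adj x hx i hi).1 hz.symm
      rcases h1 i hi with h | h
      · rw [h3] at h
        exact Bool.noConfusion h
      · exact ((hR.adj y hy i hi).2 h).symm
    · push Not at hn
      obtain ⟨m, hm, ht⟩ := hO z hn
      have h3 := (ht x hx).1 hz
      rcases h2 m hm with h | h
      · rw [h3] at h
        exact Bool.noConfusion h
      · exact (ht y hy).2 h
  obtain ⟨f, hf⟩ := hC.col (σ x)
  classical
  refine hC.ncol (fun z => if z = σ x then f (σ y) else f z) ?_
  intro a b hab
  by_cases ha : a = σ x <;> by_cases hb : b = σ x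
  · subst ha; subst hb
    exact (G.irrefl hab).elim
  · subst ha
    simp only [hb, if_true, if_false]
    exact hf _ _ hne.symm hb (key b hab.symm).symm
  · subst hb
    simp only [ha, if_true, if_false]
    exact hf _ _ ha hne.symm (key a hab)
  · simp only [ha, hb, if_false]
    exact hf _ _ ha hb hab

set_option maxHeartbeats 2000000 in
theorem good_sound (hC : Ctx G c) {nb : ℕ → ℕ} {n : ℕ} {σ : ℕ → V} {L : List ℕ}
    {w d0 d1 d2 d3 d4 : ℕ} (hR : Realizes G nb n σ) (hO : Outside G n σ L)
    (hσ : ∀ i : Fin 5, σ i = c i)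
    (h : checkLeaf nb n L (.good w d0 d1 d2 d3 d4) = true) : False := by
  simp only [checkLeaf, checkGood, Bool.and_eq_true, Nat.blt_eq, Bool.not_eq_true',
    decide_eq_true_eq] at h
  obtain ⟨⟨⟨⟨⟨⟨⟨⟨⟨⟨⟨⟨hK, hw⟩, hn⟩, hnd⟩, e0⟩, e1⟩, e2⟩, e3⟩, e4⟩, hL⟩, hN⟩, hwK⟩, hwC⟩ := h
  simp only [List.all_cons, List.all_nil, Bool.and_eq_true, Nat.blt_eq] at hK
  obtain ⟨k0, k1, k2, k3, k4, -⟩ := hK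
  have hC5 : IsC5 G ![σ d0, σ d1, σ d2, σ d3, σ d4] := by
    constructor
    · have hi := hR.inj
      simp only [List.nodup_cons, List.mem_cons, List.not_mem_nil, or_false, not_or] at hnd
      intro i j hij
      fin_cases i <;> fin_cases j <;> simp at hij <;> first | rfl | skip
      all_goals
        exfalso
        first
        | have := hi _ k0 _ k1 hij; omega
        | have := hi _ k0 _ k2 hij; omega
        | have := hi _ k0 _ k3 hij; omega
        | have := hi _ k0 _ k4 hij; omega
        | have := hi _ k1 _ k2 hij; omega
        | have := hi _ k1 _ k3 hij; omega
        | have := hi _ k1 _ k4 hij; omega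
        | have := hi _ k2 _ k3 hij; omega
        | have := hi _ k2 _ k4 hij; omega
        | have := hi _ k3 _ k4 hij; omega
        | have := hi _ k0 _ k1 hij.symm; omega
        | have := hi _ k0 _ k2 hij.symm; omega
        | have := hi _ k0 _ k3 hij.symm; omega
        | have := hi _ k0 _ k4 hij.symm; omega
        | have := hi _ k1 _ k2 hij.symm; omega
        | have := hi _ k1 _ k3 hij.symm; omega
        | have := hi _ k1 _ k4 hij.symm; omega
        | have := hi _ k2 _ k3 hij.symm; omega
        | have := hi _ k2 _ k4 hij.symm; omega
        | have := hi _ k3 _ k4 hij.symm; omega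
    · intro i
      fin_cases i
      · exact (hR.adj _ k0 _ k1).2 e0
      · exact (hR.adj _ k1 _ k2).2 e1
      · exact (hR.adj _ k2 _ k3).2 e2
      · exact (hR.adj _ k3 _ k4).2 e3
      · exact (hR.adj _ k4 _ k0).2 e4
  have hc : c = ![σ 0, σ 1, σ 2, σ 3, σ 4] := by
    funext i
    rw [← hσ i]
    fin_cases i <;> rfl
  -- translation of coverage
  have covI : ∀ a0 a1 a2 a3 a4 : ℕ, a0 < n → a1 < n → a2 < n → a3 < n → a4 < n → ∀ i < n,
      ((∃ k : Fin 5, σ i = ![σ a0, σ a1, σ a2, σ a3, σ a4] k ∨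
        G.Adj (σ i) (![σ a0, σ a1, σ a2, σ a3, σ a4] k)) ↔
        cov nb i [a0, a1, a2, a3, a4] = true) := by
    intro a0 a1 a2 a3 a4 h0 h1 h2 h3 h4 i hi
    have q : ∀ a < n, (σ i = σ a ↔ i = a) := fun a ha =>
      ⟨fun h => hR.inj _ hi _ ha h, fun h => by rw [h]⟩
    simp only [cov, hit, List.any_cons, List.any_nil, Bool.or_eq_true, Nat.beq_eq,
      Fin.exists_fin_succ, Matrix.cons_val_zero, Matrix.cons_val_succ, IsEmpty.exists_iff,
      ← hR.adj i hi _ h0, ← hR.adj i hi _ h1, ← hR.adj i hi _ h2, ← hR.adj i hi _ h3,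
      ← hR.adj i hi _ h4, q _ h0, q _ h1, q _ h2, q _ h3, q _ h4]
    tauto
  have covO : ∀ a0 a1 a2 a3 a4 : ℕ, a0 < n → a1 < n → a2 < n → a3 < n → a4 < n → ∀ z m,
      (∀ i < n, z ≠ σ i) → HasType G n σ z m →
      ((∃ k : Fin 5, z = ![σ a0, σ a1, σ a2, σ a3, σ a4] k ∨
        G.Adj z (![σ a0, σ a1, σ a2, σ a3, σ a4] k)) ↔
        hit m [a0, a1, a2, a3, a4] = true) := by
    intro a0 a1 a2 a3 a4 h0 h1 h2 h3 h4 z m hz ht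
    simp only [hit, List.any_cons, List.any_nil, Bool.or_eq_true,
      Fin.exists_fin_succ, Matrix.cons_val_zero, Matrix.cons_val_succ, IsEmpty.exists_iff,
      ← ht _ h0, ← ht _ h1, ← ht _ h2, ← ht _ h3, ← ht _ h4, hz _ h0, hz _ h1, hz _ h2, hz _ h3,
      hz _ h4]
    tauto
  have hg := hC.good _ hC5 ?_ (σ w) ((covI d0 d1 d2 d3 d4 k0 k1 k2 k3 k4 w hw).2 hwK)
  · rw [hc, covI 0 1 2 3 4 (by omega) (by omega) (by omega) (by omega) (by omega) w hw, hwC] at hg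
    exact Bool.noConfusion hg
  · intro z hz
    rw [hc] at hz
    by_cases hzn : ∃ i < n, z = σ i
    · obtain ⟨i, hi, rfl⟩ := hzn
      rw [covI 0 1 2 3 4 (by omega) (by omega) (by omega) (by omega) (by omega) i hi] at hz
      rw [covI d0 d1 d2 d3 d4 k0 k1 k2 k3 k4 i hi]
      simp only [List.all_eq_true, List.mem_range, Bool.or_eq_true, Bool.not_eq_true'] at hN
      rcases hN i hi with h | h
      · rw [hz] at h
        exact Bool.noConfusion h
      · exact h
    · push Not at hzn
      obtain ⟨m, hm, ht⟩ := hO z hzn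
      rw [covO 0 1 2 3 4 (by omega) (by omega) (by omega) (by omega) (by omega) z m hzn ht] at hz
      rw [covO d0 d1 d2 d3 d4 k0 k1 k2 k3 k4 z m hzn ht]
      simp only [List.all_eq_true, Bool.or_eq_true, Bool.not_eq_true'] at hL
      rcases hL m hm with h | h
      · rw [hz] at h
        exact Bool.noConfusion h
      · exact h

/-- The mask `a` consists of named vertices other than `x` which have colour `k`. -/
def Part (f : V → Fin 3) (σ : ℕ → V) (n x : ℕ) (k : Fin 3) (a : ℕ) : Prop :=
  ∀ j, a.testBit j = true → j < n ∧ j ≠ x ∧ f (σ j) = k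

theorem Part.insert {f : V → Fin 3} {σ : ℕ → V} {n x : ℕ} {k : Fin 3} {a i : ℕ}
    (h : Part f σ n x k a) (hi : i < n) (hx : i ≠ x) (hk : f (σ i) = k) :
    Part f σ n x k (a ||| 2 ^ i) := by
  intro j hj
  rw [Nat.testBit_or, Bool.or_eq_true] at hj
  rcases hj with hj | hj
  · exact h j hj
  · rw [Nat.testBit_two_pow, decide_eq_true_eq] at hj
    subst hj
    exact ⟨hi, hx, hk⟩

theorem done_sound (hC : Ctx G c) {nb : ℕ → ℕ} {n : ℕ} {σ : ℕ → V} {L : List ℕ} {x : ℕ}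
    (hR : Realizes G nb n σ) (hO : Outside G n σ L) (hx : x < n) {f : V → Fin 3}
    (hf : ∀ y z, y ≠ σ x → z ≠ σ x → G.Adj y z → f y ≠ f z) (F g : Fin 3 → ℕ)
    (hF : ∀ k, Part f σ n x k (F k))
    (hg : ∀ i < n, ∃ k, (g k).testBit i = true)
    (hp : ∀ i < n, ∀ k, (g k).testBit i = true → isZ (nb i &&& g k) = true)
    (hL : ∀ m ∈ L, ∀ k, isZ (g k &&& m) = true ∨ isZ (F k &&& m) = false) : False := by
  classical
  have hg' : ∀ i, ∃ k, i < n → (g k).testBit i = true := by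
    intro i
    by_cases hi : i < n
    · obtain ⟨k, hk⟩ := hg i hi
      exact ⟨k, fun _ => hk⟩
    · exact ⟨0, fun h => absurd h hi⟩
  choose col hcol using hg'
  let idx : V → ℕ := fun z => if h : ∃ i, i < n ∧ z = σ i then h.choose else n
  have idx1 : ∀ i < n, idx (σ i) = i := by
    intro i hi
    have h : ∃ j, j < n ∧ σ i = σ j := ⟨i, hi, rfl⟩
    have h2 := h.choose_spec
    have h3 : idx (σ i) = h.choose := dif_pos h
    rw [h3]
    exact (hR.inj _ hi _ h2.1 h2.2).symm
  have idx2 : ∀ z, (∀ i < n, z ≠ σ i) → idx z = n := by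
    intro z hz
    refine dif_neg ?_
    rintro ⟨i, hi, h⟩
    exact hz i hi h
  have mixed : ∀ i < n, ∀ z, (∀ i < n, z ≠ σ i) → G.Adj z (σ i) → f z ≠ col i := by
    intro i hi z hz hadj
    obtain ⟨m, hm, ht⟩ := hO z hz
    have h1 := (ht i hi).1 hadj
    rcases hL m hm (col i) with h | h
    · exact (isZ_true h i (hcol i hi) h1).elim
    · obtain ⟨j, hj1, hj2⟩ := isZ_false h
      obtain ⟨hjn, hjx, hjc⟩ := hF (col i) j hj1
      rw [← hjc]
      refine hf _ _ (hz x hx) (fun he => hjx (hR.inj _ hjn _ hx he)) ((ht j hjn).2 hj2)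
  refine hC.ncol (fun z => if idx z < n then col (idx z) else f z) ?_
  intro y z hyz
  by_cases hy : ∃ i < n, y = σ i <;> by_cases hz : ∃ i < n, z = σ i
  · obtain ⟨i, hi, rfl⟩ := hy
    obtain ⟨j, hj, rfl⟩ := hz
    simp only [idx1 i hi, idx1 j hj, hi, hj, if_true]
    intro he
    have h1 := hp i hi (col i) (hcol i hi)
    refine isZ_true h1 j ((hR.adj i hi j hj).1 hyz) ?_
    rw [he]
    exact hcol j hj
  · obtain ⟨i, hi, rfl⟩ := hy
    push Not at hz
    simp only [idx1 i hi, idx2 z hz, hi, if_true, lt_irrefl, if_false]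
    exact (mixed i hi z hz hyz.symm).symm
  · obtain ⟨j, hj, rfl⟩ := hz
    push Not at hy
    simp only [idx1 j hj, idx2 y hy, hj, if_true, lt_irrefl, if_false]
    exact mixed j hj y hy hyz
  · push Not at hy hz
    simp only [idx2 y hy, idx2 z hz, lt_irrefl, if_false]
    exact hf _ _ (hy x hx) (hz x hx) hyz

theorem checkCC_sound (hC : Ctx G c) {nb : ℕ → ℕ} {n : ℕ} {σ : ℕ → V} {L : List ℕ} {x : ℕ}
    (hR : Realizes G nb n σ) (hO : Outside G n σ L) (hx : x < n) {f : V → Fin 3}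
    (hf : ∀ y z, y ≠ σ x → z ≠ σ x → G.Adj y z → f y ≠ f z) (t : CC) :
    ∀ f0 f1 f2 : ℕ, Part f σ n x 0 f0 → Part f σ n x 1 f1 → Part f σ n x 2 f2 →
      checkCC nb n L x t f0 f1 f2 = true → False := by
  induction t with
  | bad =>
    intro f0 f1 f2 _ _ _ h
    exact Bool.noConfusion h
  | done g0 g1 g2 =>
    intro f0 f1 f2 p0 p1 p2 h
    simp only [checkCC, checkDone, Bool.and_eq_true, List.all_eq_true, List.mem_range,
      Bool.or_eq_true, Bool.not_eq_true'] at h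
    obtain ⟨h1, h2⟩ := h
    refine done_sound hC hR hO hx hf ![f0, f1, f2] ![g0, g1, g2] ?_ ?_ ?_ ?_
    · intro k
      fin_cases k
      · exact p0
      · exact p1
      · exact p2
    · intro i hi
      rcases (h1 i hi).1.1.1 with (h | h) | h
      · exact ⟨0, h⟩
      · exact ⟨1, h⟩
      · exact ⟨2, h⟩
    · intro i hi k hk
      obtain ⟨⟨⟨-, h3⟩, h4⟩, h5⟩ := h1 i hi
      fin_cases k
      · exact h3.resolve_left (fun h => by rw [show g0.testBit i = true from hk] at h; simp at h)
      · exact h4.resolve_left (fun h => by rw [show g1.testBit i = true from hk] at h; simp at h)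
      · exact h5.resolve_left (fun h => by rw [show g2.testBit i = true from hk] at h; simp at h)
    · intro m hm k
      obtain ⟨⟨h3, h4⟩, h5⟩ := h2 m hm
      fin_cases k
      · exact h3
      · exact h4
      · exact h5
  | split i c0 c1 c2 ih0 ih1 ih2 =>
    intro f0 f1 f2 p0 p1 p2 h
    simp only [checkCC, Bool.and_eq_true, Nat.blt_eq, Bool.or_eq_true, Bool.not_eq_true'] at h
    obtain ⟨⟨⟨⟨hi, hix⟩, h0⟩, h1⟩, h2⟩ := h
    replace hix := Nat.ne_of_beq_eq_false hix
    have infeasible : ∀ k a, Part f σ n x k a → f (σ i) = k → isZ (nb i &&& a) = false →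
        False := by
      intro k a hp hk hz
      obtain ⟨j, hj1, hj2⟩ := isZ_false hz
      obtain ⟨hjn, hjx, hjc⟩ := hp j hj2
      refine hf (σ i) (σ j) (fun he => hix (hR.inj _ hi _ hx he))
        (fun he => hjx (hR.inj _ hjn _ hx he)) ((hR.adj i hi j hjn).2 hj1) ?_
      rw [hk, hjc]
    have hk : f (σ i) = 0 ∨ f (σ i) = 1 ∨ f (σ i) = 2 := by
      generalize f (σ i) = k
      fin_cases k <;> simp
    rcases hk with hk | hk | hk
    · rcases h0 with h | h
      · exact infeasible _ _ p0 hk h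
      · exact ih0 _ _ _ (p0.insert hi hix hk) p1 p2 h
    · rcases h1 with h | h
      · exact infeasible _ _ p1 hk h
      · exact ih1 _ _ _ p0 (p1.insert hi hix hk) p2 h
    · rcases h2 with h | h
      · exact infeasible _ _ p2 hk h
      · exact ih2 _ _ _ p0 p1 (p2.insert hi hix hk) h

theorem perm_exists : ∀ a b : Fin 3, a ≠ b → ∃ e : Equiv.Perm (Fin 3), e a = 0 ∧ e b = 1 := by
  decide

theorem color_sound (hC : Ctx G c) {nb : ℕ → ℕ} {n : ℕ} {σ : ℕ → V} {L : List ℕ} {x p q : ℕ}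
    {t : CC} (hR : Realizes G nb n σ) (hO : Outside G n σ L)
    (h : checkLeaf nb n L (.color x p q t) = true) : False := by
  simp only [checkLeaf, Bool.and_eq_true, Nat.blt_eq, Bool.not_eq_true'] at h
  obtain ⟨⟨⟨⟨⟨⟨hx, hp⟩, hq⟩, hpx⟩, hqx⟩, hpq⟩, h⟩ := h
  replace hpx := Nat.ne_of_beq_eq_false hpx
  replace hqx := Nat.ne_of_beq_eq_false hqx
  obtain ⟨f, hf⟩ := hC.col (σ x)
  have hne := hf (σ p) (σ q) (fun he => hpx (hR.inj _ hp _ hx he))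
    (fun he => hqx (hR.inj _ hq _ hx he)) ((hR.adj p hp q hq).2 hpq)
  obtain ⟨e, e0, e1⟩ := perm_exists _ _ hne
  refine checkCC_sound hC hR hO hx (f := fun z => e (f z)) ?_ t _ _ _ ?_ ?_ ?_ h
  · intro y z hy hz hyz he
    exact hf y z hy hz hyz (e.injective he)
  · intro j hj
    rw [Nat.testBit_two_pow, decide_eq_true_eq] at hj
    subst hj
    exact ⟨hp, hpx, e0⟩
  · intro j hj
    rw [Nat.testBit_two_pow, decide_eq_true_eq] at hj
    subst hj
    exact ⟨hq, hqx, e1⟩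
  · intro j hj
    simp at hj

theorem check_sound (hC : Ctx G c) (t : Cert) : ∀ (nb : ℕ → ℕ) (n : ℕ) (L : List ℕ) (σ : ℕ → V),
    Realizes G nb n σ → Outside G n σ L → 5 ≤ n → (∀ i : Fin 5, σ i = c i) →
    check t nb n L = true → False := by
  induction t with
  | leaf l =>
    intro nb n L σ hR hO _ hσ h
    cases l with
    | dom x y => exact dom_sound hC hR hO h
    | good w d0 d1 d2 d3 d4 => exact good_sound hC hR hO hσ h
    | color x p q t => exact color_sound hC hR hO h
  | elim m hints L' sub rest ihs ihr =>
    intro nb n L σ hR hO hn hσ h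
    simp only [check, Bool.and_eq_true, List.all_eq_true, Nat.blt_eq] at h
    obtain ⟨⟨⟨⟨hL, hm⟩, hcov⟩, hsub⟩, hrest⟩ := h
    by_cases hz : ∃ z, (∀ i < n, z ≠ σ i) ∧ HasType G n σ z m
    · obtain ⟨z, hz, ht⟩ := hz
      have hR' := realizes_ext hR hz ht hm
      refine ihs _ (n + 1) L' (ext σ n z) hR'
        (covers_sound hC hR' (cands_lt hL) (cands_sound hL hO) hcov) (by omega) ?_ hsub
      intro i
      rw [ext_lt σ z (by omega)]
      exact hσ i
    · refine ihr nb n _ σ hR ?_ hn hσ hrest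
      intro y hy
      obtain ⟨m', hm', ht⟩ := hO y hy
      refine ⟨m', ?_, ht⟩
      rw [List.mem_filter]
      refine ⟨hm', ?_⟩
      rw [Bool.not_eq_true', ← Bool.not_eq_true, Nat.beq_eq]
      rintro rfl
      exact hz ⟨y, hy, ht⟩

theorem exists_mask (P : ℕ → Prop) (n : ℕ) :
    ∃ m < 2 ^ n, ∀ i < n, (P i ↔ m.testBit i = true) := by
  induction n with
  | zero => exact ⟨0, by simp, fun i hi => absurd hi (by omega)⟩
  | succ n ih =>
    obtain ⟨m, hm, h⟩ := ih
    have h2 : 2 ^ n < 2 ^ (n + 1) := Nat.pow_lt_pow_right (by norm_num) (by omega)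
    by_cases hP : P n
    · refine ⟨m ||| 2 ^ n, Nat.or_lt_two_pow (by omega) h2, ?_⟩
      intro i hi
      rcases Nat.lt_succ_iff_lt_or_eq.1 hi with h' | h'
      · have : ¬ n = i := by omega
        simp [h i h', Nat.testBit_or, Nat.testBit_two_pow, this]
      · subst h'
        simp [hP, Nat.testBit_or]
    · refine ⟨m, by omega, ?_⟩
      intro i hi
      rcases Nat.lt_succ_iff_lt_or_eq.1 hi with h' | h'
      · exact h i h'
      · subst h'
        simp [hP, Nat.testBit_lt_two_pow hm]

/-- The root configuration is impossible. -/
theorem root_false (hC : Ctx G c) (σ : ℕ → V)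
    (hR : Realizes G (fun i => rootNb.getD i 0) 8 σ) (hσ : ∀ i : Fin 5, σ i = c i) : False := by
  have h := rootCheck_true
  unfold rootCheck at h
  rw [Bool.and_eq_true] at h
  refine check_sound hC rootCert _ 8 rootTypes σ hR ?_ (by norm_num) hσ h.2
  refine covers_sound hC hR ?_ ?_ h.1
  · intro m hm
    rw [List.mem_range] at hm
    exact hm
  · intro z _
    obtain ⟨m, hm, h⟩ := exists_mask (fun i => G.Adj z (σ i)) 8
    exact ⟨m, List.mem_range.2 hm, h⟩

end Sound


/-! ## From a minimal counterexample to the facts used by the checker -/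

theorem tf_of {V : Type} {G : SimpleGraph V} (h : G.CliqueFree 3) (x y z : V)
    (h1 : G.Adj x y) (h2 : G.Adj y z) (h3 : G.Adj x z) : False := by
  classical
  exact h {x, y, z} (is3Clique_triple_iff.2 ⟨h1, h3, h2⟩)

theorem ff_of {V : Type} {G : SimpleGraph V} (h3 : G.CliqueFree 3) (hF : ForkFree G)
    (v l1 l2 p p2 q q2 : V) (e1 : G.Adj v l1) (e2 : G.Adj v l2) (e3 : G.Adj v p)
    (e4 : G.Adj v q) (e5 : G.Adj p p2) (e6 : G.Adj q q2)
    (n1 : ¬ G.Adj p2 q) (n2 : ¬ G.Adj p2 q2) (n3 : ¬ G.Adj p2 l1) (n4 : ¬ G.Adj p2 l2)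
    (n5 : ¬ G.Adj q2 p) (n6 : ¬ G.Adj q2 l1) (n7 : ¬ G.Adj q2 l2) (hl : l1 ≠ l2) : False := by
  have tf := tf_of h3
  have m1 : ¬ G.Adj v p2 := fun h => tf v p p2 e3 e5 h
  have m2 : ¬ G.Adj v q2 := fun h => tf v q q2 e4 e6 h
  have m3 : ¬ G.Adj l1 l2 := fun h => tf v l1 l2 e1 h e2
  have m4 : ¬ G.Adj l1 p := fun h => tf v l1 p e1 h e3
  have m5 : ¬ G.Adj l1 q := fun h => tf v l1 q e1 h e4
  have m6 : ¬ G.Adj l2 p := fun h => tf v l2 p e2 h e3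
  have m7 : ¬ G.Adj l2 q := fun h => tf v l2 q e2 h e4
  have m8 : ¬ G.Adj p q := fun h => tf v p q e3 h e4
  have hadj : ∀ i j : Fin 7, G.Adj (![v, l1, l2, p, p2, q, q2] i) (![v, l1, l2, p, p2, q, q2] j) ↔
      fork.Adj i j := by
    intro i j
    fin_cases i <;> fin_cases j <;>
      simp [fork, *, e1.symm, e2.symm, e3.symm, e4.symm, e5.symm, e6.symm, G.adj_comm p2 v,
        G.adj_comm q2 v, G.adj_comm l2 l1, G.adj_comm p l1, G.adj_comm q l1, G.adj_comm p l2,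
        G.adj_comm q l2, G.adj_comm q p, G.adj_comm q p2, G.adj_comm q2 p2, G.adj_comm l1 p2,
        G.adj_comm l2 p2, G.adj_comm p q2, G.adj_comm l1 q2, G.adj_comm l2 q2]
  have hinj : Function.Injective ![v, l1, l2, p, p2, q, q2] := by
    intro i j hij
    by_contra hne
    have hr : ∀ k : Fin 7, fork.Adj i k ↔ fork.Adj j k := by
      intro k
      rw [← hadj, ← hadj, hij]
    have key : (i = 1 ∧ j = 2) ∨ (i = 2 ∧ j = 1) := by
      clear hij hadj
      revert hr hne
      revert i j
      simp only [fork, SimpleGraph.fromEdgeSet_adj]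
      decide
    rcases key with ⟨rfl, rfl⟩ | ⟨rfl, rfl⟩
    · exact hl hij
    · exact hl hij.symm
  exact hF.false ⟨⟨_, hinj⟩, fun {i j} => hadj i j⟩

theorem colorable_induce {V : Type} [Fintype V] {G : SimpleGraph V} (hG : MinCex G)
    (A : Set V) (x : V) (hx : x ∉ A) : (G.induce A).Colorable 3 := by
  classical
  obtain ⟨h3, hF, _, hmin⟩ := hG
  have h := hmin A (G.induce A) ?_ ?_ ?_
  · exact chromaticNumber_le_iff_colorable.1 h
  · exact Fintype.card_subtype_lt (p := (· ∈ A)) hx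
  · exact h3.comap (Embedding.induce A).isContained
  · exact ⟨fun f => hF.false (f.trans (Embedding.induce A))⟩

theorem ncol_of {V : Type} [Fintype V] {G : SimpleGraph V} (hG : MinCex G)
    (f : V → Fin 3) (h : ∀ y z, G.Adj y z → f y ≠ f z) : False := by
  have h4 := hG.2.2.1
  have : G.Colorable 3 := ⟨Coloring.mk f fun {y z} => h y z⟩
  have h5 := chromaticNumber_le_iff_colorable.2 this
  have := h4.trans h5
  exact absurd this (by decide)

/-- Extend a 3-coloring of an induced subgraph. -/
theorem exists_col {V : Type} [Fintype V] {G : SimpleGraph V} (hG : MinCex G)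
    (A : Set V) (x : V) (hx : x ∉ A) :
    ∃ f : V → Fin 3, ∀ y z, y ∈ A → z ∈ A → G.Adj y z → f y ≠ f z := by
  classical
  obtain ⟨C⟩ := colorable_induce hG A x hx
  refine ⟨fun y => if h : y ∈ A then C ⟨y, h⟩ else 0, ?_⟩
  intro y z hy hz hyz
  simp only [hy, hz, dif_pos]
  exact C.valid (by simpa using hyz)

theorem reach_of {V : Type} [Fintype V] {G : SimpleGraph V} (hG : MinCex G) (v w : V) :
    G.Reachable v w := by
  classical
  by_contra hvw
  obtain ⟨f, hf⟩ := exists_col hG {z | G.Reachable v z} w hvw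
  obtain ⟨g, hg⟩ := exists_col hG {z | ¬ G.Reachable v z} v (by simp)
  refine ncol_of hG (fun z => if G.Reachable v z then f z else g z) ?_
  intro y z hyz
  by_cases hy : G.Reachable v y
  · have hz : G.Reachable v z := hy.trans hyz.reachable
    simp only [hy, hz, if_true]
    exact hf y z hy hz hyz
  · have hz : ¬ G.Reachable v z := fun h => hy (h.trans hyz.symm.reachable)
    simp only [hy, hz, if_false]
    exact hg y z hy hz hyz

theorem two_le_distC {V : Type} [Fintype V] {G : SimpleGraph V} (hG : MinCex G)
    (d : Fin 5 → V) (z : V) : 2 ≤ distC G d z ↔ ∀ i, z ≠ d i ∧ ¬ G.Adj z (d i) := by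
  unfold distC
  rw [Finset.le_inf'_iff]
  refine ⟨fun h i => ?_, fun h i _ => ?_⟩
  · have hi := h i (Finset.mem_univ i)
    refine ⟨fun e => ?_, fun e => ?_⟩
    · rw [e, SimpleGraph.dist_self] at hi
      omega
    · rw [SimpleGraph.dist_eq_one_iff_adj.2 e] at hi
      omega
  · obtain ⟨h1, h2⟩ := h i
    have h3 := (reach_of hG z (d i)).pos_dist_of_ne h1
    have h4 : G.dist z (d i) ≠ 1 := fun e => h2 (SimpleGraph.dist_eq_one_iff_adj.1 e)
    omega

theorem ctx_of {V : Type} [Fintype V] {G : SimpleGraph V} (hG : MinCex G) {c : Fin 5 → V}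
    (hc : GoodC5 G c) : Ctx G c where
  tf := tf_of hG.1
  ff := ff_of hG.1 hG.2.1
  col x := by
    obtain ⟨f, hf⟩ := exists_col hG {x}ᶜ x (by simp)
    exact ⟨f, fun y z hy hz => hf y z hy hz⟩
  ncol := ncol_of hG
  good d hd hsub w hw := by
    by_contra hcon
    have hle := hc.2 d hd
    refine absurd (Set.ncard_lt_ncard (s := {u : V | 2 ≤ distC G d u})
      (t := {u : V | 2 ≤ distC G c u}) ?_ (Set.toFinite _)) (by omega)
    refine ⟨?_, ?_⟩
    · intro z hz
      simp only [Set.mem_ofPred_eq, two_le_distC hG] at hz ⊢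
      by_contra hn
      push Not at hn
      obtain ⟨i, hi⟩ := hn
      have : ∃ i, z = c i ∨ G.Adj z (c i) := ⟨i, by tauto⟩
      obtain ⟨j, hj⟩ := hsub z this
      have := hz j
      tauto
    · intro hss
      have hwc : w ∈ {u : V | 2 ≤ distC G c u} := by
        simp only [Set.mem_ofPred_eq, two_le_distC hG]
        intro i
        exact ⟨fun h => hcon ⟨i, Or.inl h⟩, fun h => hcon ⟨i, Or.inr h⟩⟩
      have := hss hwc
      simp only [Set.mem_ofPred_eq, two_le_distC hG] at this
      obtain ⟨i, hi⟩ := hw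
      have := this i
      tauto

/-- The facts are invariant under reindexing the cycle. -/
theorem Ctx.reindex {V : Type} {G : SimpleGraph V} {c : Fin 5 → V} (h : Ctx G c)
    (e : Fin 5 → Fin 5) (he : Function.Surjective e) : Ctx G (c ∘ e) where
  tf := h.tf
  ff := h.ff
  col := h.col
  ncol := h.ncol
  good d hd hsub w hw := by
    obtain ⟨i, hi⟩ := h.good d hd (fun z ⟨i, hi⟩ => by
      obtain ⟨j, rfl⟩ := he i
      exact hsub z ⟨j, hi⟩) w hw
    obtain ⟨j, rfl⟩ := he i
    exact ⟨j, hi⟩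

/-- The configuration `a ~ c 2`, `b ~ c 3` is impossible. -/
theorem core {V : Type} {G : SimpleGraph V} {c : Fin 5 → V} (h : Ctx G c) (hc : IsC5 G c)
    {a b u : V} (hu : ∀ i, u ≠ c i ∧ ¬ G.Adj u (c i)) (hac : ∀ i, a ≠ c i) (hbc : ∀ i, b ≠ c i)
    (ha : G.Adj (c 0) a) (hb : G.Adj (c 0) b) (ha2 : G.Adj (c 2) a) (hb3 : G.Adj (c 3) b)
    (hua : G.Adj u a) (hub : ¬ G.Adj u b) : False := by
  have tf := h.tf
  have e0 : G.Adj (c 0) (c 1) := hc.2 0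
  have e1 : G.Adj (c 1) (c 2) := hc.2 1
  have e2 : G.Adj (c 2) (c 3) := hc.2 2
  have e3 : G.Adj (c 3) (c 4) := hc.2 3
  have e4 : G.Adj (c 4) (c 0) := hc.2 4
  have n1 : ¬ G.Adj (c 0) (c 2) := fun x => tf _ _ _ e0 e1 x
  have n2 : ¬ G.Adj (c 1) (c 3) := fun x => tf _ _ _ e1 e2 x
  have n3 : ¬ G.Adj (c 2) (c 4) := fun x => tf _ _ _ e2 e3 x
  have n4 : ¬ G.Adj (c 3) (c 0) := fun x => tf _ _ _ e3 e4 x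
  have n5 : ¬ G.Adj (c 4) (c 1) := fun x => tf _ _ _ e4 e0 x
  have a1 : ¬ G.Adj (c 1) a := fun x => tf _ _ _ e0 x ha
  have a3 : ¬ G.Adj (c 3) a := fun x => tf _ _ _ e2 x ha2
  have a4 : ¬ G.Adj (c 4) a := fun x => tf _ _ _ e4 ha x
  have b1 : ¬ G.Adj (c 1) b := fun x => tf _ _ _ e0 x hb
  have b2 : ¬ G.Adj (c 2) b := fun x => tf _ _ _ e2 hb3 x
  have b4 : ¬ G.Adj (c 4) b := fun x => tf _ _ _ e4 hb x
  have ab : ¬ G.Adj a b := fun x => tf _ _ _ ha x hb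
  have u0 := (hu 0).2
  have u1 := (hu 1).2
  have u2 := (hu 2).2
  have u3 := (hu 3).2
  have u4 := (hu 4).2
  have hadj : ∀ i j : Fin 8, G.Adj (![c 0, c 1, c 2, c 3, c 4, a, b, u] i)
      (![c 0, c 1, c 2, c 3, c 4, a, b, u] j) ↔ (rootNb.getD i 0).testBit j = true := by
    intro i j
    fin_cases i <;> fin_cases j <;>
      simp [rootNb, Nat.testBit, e0, e1, e2, e3, e4, ha, hb, ha2, hb3, hua, hub, n1, n2, n3, n4, n5,
        a1, a3, a4, b1, b2, b4, ab, u0, u1, u2, u3, u4, G.adj_comm (c 1) (c 0),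
        G.adj_comm (c 2) (c 1), G.adj_comm (c 3) (c 2), G.adj_comm (c 4) (c 3),
        G.adj_comm (c 0) (c 4), G.adj_comm (c 2) (c 0), G.adj_comm (c 3) (c 1),
        G.adj_comm (c 4) (c 2), G.adj_comm (c 0) (c 3), G.adj_comm (c 1) (c 4),
        G.adj_comm a (c _), G.adj_comm b (c _), G.adj_comm (c _) u, G.adj_comm b a,
        G.adj_comm a u, G.adj_comm b u]
  have hinj : ∀ i j : Fin 8, ![c 0, c 1, c 2, c 3, c 4, a, b, u] i =
      ![c 0, c 1, c 2, c 3, c 4, a, b, u] j → i = j := by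
    intro i j hij
    by_contra hne
    have hr : ∀ k : Fin 8, (rootNb.getD i 0).testBit k = (rootNb.getD j 0).testBit k := by
      intro k
      rw [Bool.eq_iff_iff, ← hadj, ← hadj, hij]
    have key : (i = 4 ∧ j = 6) ∨ (i = 6 ∧ j = 4) := by
      clear hij hadj
      revert hr hne
      revert i j
      decide
    rcases key with ⟨rfl, rfl⟩ | ⟨rfl, rfl⟩
    · exact hbc 4 hij.symm
    · exact hbc 4 hij
  let σ : ℕ → V := fun n => if hn : n < 8 then ![c 0, c 1, c 2, c 3, c 4, a, b, u] ⟨n, hn⟩ else u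
  have hs : ∀ n (hn : n < 8), σ n = ![c 0, c 1, c 2, c 3, c 4, a, b, u] ⟨n, hn⟩ := by
    intro n hn
    simp only [σ, hn, dif_pos]
  refine root_false h σ ⟨?_, ?_, ?_⟩ ?_
  · intro i hi j hj
    rw [hs i hi, hs j hj]
    exact hadj ⟨i, hi⟩ ⟨j, hj⟩
  · intro i hi j hj hij
    rw [hs i hi, hs j hj] at hij
    exact congrArg Fin.val (hinj _ _ hij)
  · decide
  · intro i
    rw [hs i (by omega)]
    fin_cases i <;> rfl

/-- The two edges forced by the fork centred at `c 0`. -/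
theorem step {V : Type} {G : SimpleGraph V} {c : Fin 5 → V} (h : Ctx G c) (hc : IsC5 G c)
    {a b u : V} (hu : ∀ i, u ≠ c i ∧ ¬ G.Adj u (c i)) (hbc : ∀ i, b ≠ c i)
    (ha : G.Adj (c 0) a) (hb : G.Adj (c 0) b)
    (hua : G.Adj u a) (hub : ¬ G.Adj u b) : G.Adj (c 2) a ∨ G.Adj (c 2) b := by
  by_contra hcon
  push Not at hcon
  have tf := h.tf
  have e0 : G.Adj (c 0) (c 1) := hc.2 0
  have e1 : G.Adj (c 1) (c 2) := hc.2 1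
  have e2 : G.Adj (c 2) (c 3) := hc.2 2
  have e3 : G.Adj (c 3) (c 4) := hc.2 3
  have e4 : G.Adj (c 4) (c 0) := hc.2 4
  exact h.ff (c 0) (c 4) b a u (c 1) (c 2) e4.symm hb ha e0 hua.symm e1
    (hu 1).2 (hu 2).2 (hu 4).2 hub hcon.1 (fun x => tf _ _ _ e2 e3 x) hcon.2 (hbc 4).symm

theorem half0 {V : Type} {G : SimpleGraph V} {c : Fin 5 → V} (h : Ctx G c) (hc : IsC5 G c)
    {a b u : V} (hu : ∀ i, u ≠ c i ∧ ¬ G.Adj u (c i)) (hac : ∀ i, a ≠ c i) (hbc : ∀ i, b ≠ c i)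
    (ha : G.Adj (c 0) a) (hb : G.Adj (c 0) b)
    (hua : G.Adj u a) (hub : ¬ G.Adj u b) : False := by
  have hsurj : Function.Surjective (fun i : Fin 5 => -i) := neg_surjective
  have h' := h.reindex _ hsurj
  have hc' : IsC5 G (c ∘ fun i : Fin 5 => -i) := by
    refine ⟨hc.1.comp neg_injective, fun i => ?_⟩
    have := hc.2 (-(i + 1))
    have e : -(i + 1) + 1 = -i := by abel
    rw [e] at this
    exact this.symm
  have hu' : ∀ i, u ≠ (c ∘ fun i : Fin 5 => -i) i ∧ ¬ G.Adj u ((c ∘ fun i : Fin 5 => -i) i) :=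
    fun i => hu _
  have s1 := step h hc hu hbc ha hb hua hub
  have s2 : G.Adj (c 3) a ∨ G.Adj (c 3) b :=
    step h' hc' hu' (fun i => hbc _) ha hb hua hub
  have e2 : G.Adj (c 2) (c 3) := hc.2 2
  rcases s1 with s1 | s1 <;> rcases s2 with s2 | s2
  · exact h.tf _ _ _ e2 s2 s1
  · exact core h hc hu hac hbc ha hb s1 s2 hua hub
  · exact core h' hc' hu' (fun i => hac _) (fun i => hbc _) ha hb s2 s1 hua hub
  · exact h.tf _ _ _ e2 s2 s1

theorem half {V : Type} {G : SimpleGraph V} {c : Fin 5 → V} (h : Ctx G c) (hc : IsC5 G c)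
    {a b u : V} (k : Fin 5) (hu : ∀ i, u ≠ c i ∧ ¬ G.Adj u (c i)) (hac : ∀ i, a ≠ c i)
    (hbc : ∀ i, b ≠ c i) (ha : G.Adj (c k) a) (hb : G.Adj (c k) b)
    (hua : G.Adj u a) : G.Adj u b := by
  by_contra hub
  have hc' : IsC5 G (c ∘ fun i : Fin 5 => k + i) := by
    refine ⟨hc.1.comp (add_right_injective k), fun i => ?_⟩
    have := hc.2 (k + i)
    rw [add_assoc] at this
    exact this
  exact half0 (h.reindex (fun i => k + i) (add_left_surjective k)) hc' (fun i => hu _)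
    (fun i => hac _) (fun i => hbc _) (by simpa using ha) (by simpa using hb) hua hub

end ForkProof

theorem minCex_no_partial_diamond {V : Type} [Fintype V]
    (G : SimpleGraph V) (hG : MinCex G) (c : Fin 5 → V) (hc : GoodC5 G c)
    (u : V) (hu : distC G c u = 2) (k : Fin 5) (a b : V)
    (ha : G.Adj (c k) a) (hac : a ∉ Set.range c)
    (hb : G.Adj (c k) b) (hbc : b ∉ Set.range c) :
    (G.Adj u a ↔ G.Adj u b) := by
  have h := ForkProof.ctx_of hG hc
  have hu2 := (ForkProof.two_le_distC hG c u).1 hu.ge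
  have hac2 : ∀ i, a ≠ c i := fun i e => hac ⟨i, e.symm⟩
  have hbc2 : ∀ i, b ≠ c i := fun i e => hbc ⟨i, e.symm⟩
  exact ⟨ForkProof.half h hc.1 k hu2 hac2 hbc2 ha hb,
    ForkProof.half h hc.1 k hu2 hbc2 hac2 hb ha⟩
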